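/- The set G with the product (c₁, c₂) ⊙ (d₁, d₂) := (c₁ ⧢ d₁, c₂ + d₂ ⧢ c₁) is a group with identity element e = (𝟙, 0), and the inverse of c = (c₁, c₂) ∈ G is c^{⊙−1} = (c₁^{⧢−1}, −c₁^{⧢−1} ⧢ c₂), where c₁^{⧢−1} = Σ_{k≥0} (𝟙 − c₁)^{⧢k}. -/

import Mathlib

open scoped Classical

/-!  Common setup: noncommutative formal power series ℝ⟨⟨X⟩⟩ over the
alphabet X = {x₀, x₁}.  Words are encoded as lists over `Fin 2`
(the letter `0` is x₀ and `1` is x₁); a series is a function from words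
to ℝ, recording its coefficients. -/

/-- Words over the alphabet X = {x₀, x₁}. -/
abbrev Word : Type := List (Fin 2)

/-- Noncommutative formal power series ℝ⟨⟨X⟩⟩. -/
abbrev Ser : Type := Word → ℝ

/-- The series 𝟙 (the empty word). -/
def one1 : Ser := fun w => if w = [] then 1 else 0

/-- A single word η regarded as a series. -/
def mono (η : Word) : Ser := fun w => if w = η then 1 else 0

/-- Left concatenation of a series by the letter `x_i`. -/
def lc (i : Fin 2) (c : Ser) : Ser := fun w =>
  match w with
  | [] => 0
  | j :: u => if j = i then c u else 0

/-- Auxiliary recursion computing the coefficient of a word `w` in `c ⧢ d`: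
`(c ⧢ d)(𝟙) = c(𝟙) d(𝟙)` and
`(c ⧢ d)(x_i w) = ((x_i⁻¹ c) ⧢ d)(w) + (c ⧢ (x_i⁻¹ d))(w)`,
where `x_i⁻¹` is the left shift.  This dual recursion is exactly the
bilinear extension of the inductive shuffle of words
`(x_i ξ) ⧢ (x_j η) = x_i (ξ ⧢ x_j η) + x_j (x_i ξ ⧢ η)`, `𝟙 ⧢ η = η ⧢ 𝟙 = η`. -/
def shAux : Word → Ser → Ser → ℝ
  | [], c, d => c [] * d []
  | i :: w, c, d => shAux w (fun u => c (i :: u)) d + shAux w c (fun u => d (i :: u))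

/-- The shuffle product `⧢` on ℝ⟨⟨X⟩⟩. -/
def sh (c d : Ser) : Ser := fun w => shAux w c d

/-- Shuffle powers `c^{⧢ k}`. -/
def shPow (c : Ser) : ℕ → Ser
  | 0 => one1
  | k + 1 => sh c (shPow c k)

/-- The shuffle inverse `c^{⧢ -1} = Σ_{k ≥ 0} (𝟙 - c)^{⧢ k}`.
When `c(𝟙) = 1` the sum is locally finite (for each word only finitely many
terms are nonzero) and `∑'` returns it. -/
noncomputable def shInv (c : Ser) : Ser := fun w => ∑' k : ℕ, shPow (one1 - c) k w

/-- Composition product restricted to words: `𝟙 ∘ d = 𝟙`,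
`(x₀ η) ∘ d = x₀ (η ∘ d)`, `(x₁ η) ∘ d = x₀ (d ⧢ (η ∘ d))`. -/
def wordComp : Word → Ser → Ser
  | [], _ => one1
  | i :: η, d => if i = 0 then lc 0 (wordComp η d) else lc 0 (sh d (wordComp η d))

/-- The composition product `c ∘ d = Σ_η c(η) (η ∘ d)`.  For each fixed word
only finitely many terms are nonzero, and `∑'` returns the sum. -/
noncomputable def comp (c d : Ser) : Ser := fun w => ∑' η : Word, c η * wordComp η d w

/-- Membership in the set `G`: pairs `(d₁, d₂)` with `d₁(𝟙) = 1`. -/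
def inG (d : Ser × Ser) : Prop := d.1 [] = 1

/-- Mixed composition product restricted to words: `𝟙 ◁ d = 𝟙`,
`(x₀ η) ◁ d = x₀ (η ◁ d)`,
`(x₁ η) ◁ d = x₁ (d₁ ⧢ (η ◁ d)) + x₀ (d₂ ⧢ (η ◁ d))`. -/
def wordMComp : Word → Ser × Ser → Ser
  | [], _ => one1
  | i :: η, d =>
      if i = 0 then lc 0 (wordMComp η d)
      else lc 1 (sh d.1 (wordMComp η d)) + lc 0 (sh d.2 (wordMComp η d))

/-- The mixed composition product `c ◁ d = Σ_η c(η) (η ◁ d)`. -/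
noncomputable def mcomp (c : Ser) (d : Ser × Ser) : Ser :=
  fun w => ∑' η : Word, c η * wordMComp η d w

/-- Componentwise mixed composition `c ⊲ d = (c₁ ◁ d, c₂ ◁ d)`. -/
noncomputable def tri (c d : Ser × Ser) : Ser × Ser := (mcomp c.1 d, mcomp c.2 d)

/-- Componentwise composition `d ∘̄ c = (d₁ ∘ c, d₂ ∘ c)`. -/
noncomputable def bcomp (d : Ser × Ser) (c : Ser) : Ser × Ser := (comp d.1 c, comp d.2 c)

/-- The group product `⊙` on `G`:
`(c₁, c₂) ⊙ (d₁, d₂) = (c₁ ⧢ d₁, c₂ + d₂ ⧢ c₁)`. -/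
def odot (c d : Ser × Ser) : Ser × Ser := (sh c.1 d.1, c.2 + sh d.2 c.1)

/-- The identity element `e = (𝟙, 0)`. -/
def eG : Ser × Ser := (one1, 0)

/-- The `⊙`-inverse `c^{⊙ -1} = (c₁^{⧢ -1}, -(c₁^{⧢ -1} ⧢ c₂))`. -/
noncomputable def odotInv (c : Ser × Ser) : Ser × Ser :=
  (shInv c.1, -(sh (shInv c.1) c.2))

/-- The affine feedback group product `c ⋆ d = (c ⊲ d) ⊙ d` on `G`. -/
noncomputable def star (c d : Ser × Ser) : Ser × Ser := odot (tri c d) d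

/-- The `⋆`-inverse of an element of `G` (defined via choice; for an element
of the group `(G, ⋆)` it is the unique two-sided `⋆`-inverse). -/
noncomputable def starInv (x : Ser × Ser) : Ser × Ser :=
  if h : ∃ y : Ser × Ser, inG y ∧ star x y = eG ∧ star y x = eG then h.choose else x

/-- The affine feedback product `c @ d = c ◁ ((d^{⊙ -1}) ∘̄ c)^{⋆ -1}`. -/
noncomputable def atp (c : Ser) (d : Ser × Ser) : Ser :=
  mcomp c (starInv (bcomp (odotInv d) c))

/-- Membership in ℝ[[x₀]]: series vanishing on every word containing x₁. -/
def inRx0 (c : Ser) : Prop := ∀ w : Word, (1 : Fin 2) ∈ w → c w = 0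

theorem sh_nil (c d : Ser) : sh c d [] = c [] * d [] := rfl

theorem sh_cons (c d : Ser) (i : Fin 2) (w : Word) :
    sh c d (i :: w) = sh (fun u => c (i :: u)) d w + sh c (fun u => d (i :: u)) w := rfl

theorem sh_comm (c d : Ser) : sh c d = sh d c := by
  funext w
  induction w generalizing c d with
  | nil => simp only [sh_nil, mul_comm]
  | cons i w ih => rw [sh_cons, sh_cons, ih, ih c, add_comm]

theorem sh_add_right (c d e : Ser) : sh c (d + e) = sh c d + sh c e := by
  funext w
  induction w generalizing c d e with
  | nil => simp only [sh_nil, Pi.add_apply, mul_add]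
  | cons i w ih =>
    simp only [Pi.add_apply] at ih
    simp only [sh_cons, Pi.add_apply]
    rw [ih, show (fun u => d (i :: u) + e (i :: u)) = (fun u => d (i :: u)) + fun u => e (i :: u)
      from rfl, ih]
    ring

theorem sh_add_left (c d e : Ser) : sh (c + d) e = sh c e + sh d e := by
  rw [sh_comm, sh_add_right, sh_comm e c, sh_comm e d]

theorem sh_zero_right (c : Ser) : sh c 0 = 0 := by
  simpa using sh_add_right c 0 0

theorem sh_neg_right (c d : Ser) : sh c (-d) = -sh c d := by
  rw [eq_neg_iff_add_eq_zero, ← sh_add_right, neg_add_cancel, sh_zero_right]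

theorem sh_neg_left (c d : Ser) : sh (-c) d = -sh c d := by
  rw [sh_comm, sh_neg_right, sh_comm]

theorem sh_sub_left (c d e : Ser) : sh (c - d) e = sh c e - sh d e := by
  rw [sub_eq_add_neg, sh_add_left, sh_neg_left, ← sub_eq_add_neg]

theorem sh_assoc (c d e : Ser) : sh (sh c d) e = sh c (sh d e) := by
  funext w
  induction w generalizing c d e with
  | nil => simp only [sh_nil, mul_assoc]
  | cons i w ih =>
    have shift (a b : Ser) : (fun u => sh a b (i :: u)) =
        sh (fun u => a (i :: u)) b + sh a (fun u => b (i :: u)) := rfl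
    rw [sh_cons, sh_cons c, shift, shift, sh_add_left, sh_add_right]
    simp only [Pi.add_apply, ih, add_assoc]

theorem one1_sh (c : Ser) : sh one1 c = c := by
  funext w
  induction w generalizing c with
  | nil => simp [sh_nil, one1]
  | cons i w ih =>
    have h : (fun u => one1 (i :: u)) = 0 := by funext u; simp [one1]
    rw [sh_cons, h, ih, sh_comm, sh_zero_right, Pi.zero_apply, zero_add]

theorem sh_one1 (c : Ser) : sh c one1 = c := by
  rw [sh_comm, one1_sh]

/-- A coefficient of `c ⧢ d` only involves the coefficients of `d` on words of at most the
same length. -/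
theorem sh_congr_right {c d e : Ser} {w : Word} (h : ∀ u : Word, u.length ≤ w.length → d u = e u) :
    sh c d w = sh c e w := by
  induction w generalizing c d e with
  | nil => rw [sh_nil, sh_nil, h [] le_rfl]
  | cons i w ih =>
    rw [sh_cons, sh_cons, ih fun u hu => h u (by simp only [List.length_cons]; omega),
      ih fun u hu => h (i :: u) (by simp only [List.length_cons]; omega)]

/-- Orders of vanishing add up: if `c` has no constant term and `d` vanishes on words shorter than
`k`, then `c ⧢ d` vanishes on words shorter than `k + 1`. -/
theorem sh_apply_eq_zero {c d : Ser} {k : ℕ} (hc : c [] = 0)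
    (hd : ∀ u : Word, u.length < k → d u = 0) {w : Word} (hw : w.length < k + 1) :
    sh c d w = 0 := by
  induction w generalizing d k with
  | nil => rw [sh_nil, hc, zero_mul]
  | cons i w ih =>
    simp only [List.length_cons] at hw
    have hleft : sh (fun u => c (i :: u)) d w = 0 := by
      rw [sh_congr_right (e := 0) fun u hu => hd u (by omega), sh_zero_right, Pi.zero_apply]
    have hright : sh c (fun u => d (i :: u)) w = 0 :=
      ih (k := k - 1) (fun u hu => hd _ (by simp only [List.length_cons]; omega)) (by omega)
    rw [sh_cons, hleft, hright, add_zero]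

theorem shPow_apply_eq_zero {c : Ser} (hc : c [] = 0) {k : ℕ} {w : Word} (hw : w.length < k) :
    shPow c k w = 0 := by
  induction k generalizing w with
  | zero => omega
  | succ k ih => exact sh_apply_eq_zero hc (fun u hu => ih hu) hw

theorem one1_sub_apply_nil {c : Ser} (hc : c [] = 1) : (one1 - c) [] = 0 := by
  simp [one1, hc]

theorem shInv_apply_eq_sum {c : Ser} (hc : c [] = 1) {n : ℕ} {w : Word} (hw : w.length < n) :
    shInv c w = (∑ k ∈ Finset.range n, shPow (one1 - c) k) w := by
  rw [Finset.sum_apply]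
  refine tsum_eq_sum fun k hk => shPow_apply_eq_zero (one1_sub_apply_nil hc) ?_
  rw [Finset.mem_range] at hk
  omega

theorem sh_sum_shPow (c : Ser) (n : ℕ) :
    sh c (∑ k ∈ Finset.range n, shPow (one1 - c) k) = one1 - shPow (one1 - c) n := by
  induction n with
  | zero => simp [shPow, sh_zero_right]
  | succ n ih =>
    rw [Finset.sum_range_succ, sh_add_right, ih, shPow, sh_sub_left, one1_sh]
    abel

theorem sh_shInv {c : Ser} (hc : c [] = 1) : sh c (shInv c) = one1 := by
  funext w
  rw [sh_congr_right fun u hu => shInv_apply_eq_sum hc (Nat.lt_succ_of_le hu), sh_sum_shPow,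
    Pi.sub_apply, shPow_apply_eq_zero (one1_sub_apply_nil hc) (Nat.lt_succ_self _), sub_zero]

theorem shInv_sh {c : Ser} (hc : c [] = 1) : sh (shInv c) c = one1 := by
  rw [sh_comm, sh_shInv hc]

theorem shInv_apply_nil {c : Ser} (hc : c [] = 1) : shInv c [] = 1 := by
  have h := congrFun (sh_shInv hc) []
  rwa [sh_nil, hc, one_mul] at h

/-- `(G, ⊙)` is a group with identity `e = (𝟙, 0)` and inverse
`c^{⊙-1} = (c₁^{⧢-1}, -(c₁^{⧢-1} ⧢ c₂))`: the product is closed on `G`,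
associative, `e ∈ G` is a two-sided unit, and `c^{⊙-1}` is a two-sided
inverse lying in `G`. -/
theorem odot_group :
    (∀ c d : Ser × Ser, inG c → inG d → inG (odot c d)) ∧
    inG eG ∧
    (∀ c d f : Ser × Ser, inG c → inG d → inG f →
      odot (odot c d) f = odot c (odot d f)) ∧
    (∀ c : Ser × Ser, inG c → odot eG c = c ∧ odot c eG = c) ∧
    (∀ c : Ser × Ser, inG c →
      inG (odotInv c) ∧ odot c (odotInv c) = eG ∧ odot (odotInv c) c = eG) := by
  refine ⟨fun c d hc hd => ?_, ?_, fun c d f _ _ _ => ?_, fun c _ => ⟨?_, ?_⟩,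
    fun c hc => ⟨shInv_apply_nil hc, ?_, ?_⟩⟩
  · simp only [inG] at hc hd
    simp only [inG, odot, sh_nil, hc, hd, mul_one]
  · simp [inG, eG, one1]
  · simp only [odot, sh_add_left, sh_assoc, add_assoc, sh_comm d.1 c.1]
  · simp only [odot, eG, one1_sh, sh_one1, zero_add]
  · simp only [odot, eG, sh_one1, sh_comm 0, sh_zero_right, add_zero]
  · simp only [odot, odotInv, eG]
    rw [sh_shInv hc, sh_neg_left, sh_comm _ c.1, ← sh_assoc, sh_shInv hc, one1_sh, add_neg_cancel]
  · simp only [odot, odotInv, eG]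
    rw [shInv_sh hc, sh_comm c.2, neg_add_cancel]
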